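/- arXiv:1712.06198 — 2 statements merged into one kernel-verified Lean document; each statement's English description precedes it below -/
import Mathlib

section
/- Let L be a first-order language, let M1 and M2 be L-structures, and let h : M1 → M2 be a surjective L-homomorphism (epimorphism). Then Ultrafilter.map h : Ultrafilter M1 → Ultrafilter M2 is a surjective L-homomorphism of the ultrafilter extension β(M1) onto β(M2). (First Extension Theorem, epimorphism case.) -/
open FirstOrder Language

/-- Iterated ultrafilter quantifier. -/
def extProp {M : Type*} : ∀ {n : ℕ}, (Fin n → Ultrafilter M) → ((Fin n → M) → Prop) → Prop
  | 0, _, φ => φ Fin.elim0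
  | _ + 1, D, φ =>
      {a : M | extProp (fun i => D i.succ) (fun x => φ (Fin.cons a x))} ∈ D 0

/-- Ultrafilter extension of an `n`-ary function. -/
def extFun {M : Type*} : ∀ {n : ℕ}, (Fin n → Ultrafilter M) → ((Fin n → M) → M) → Ultrafilter M
  | 0, _, f => pure (f Fin.elim0)
  | _ + 1, D, f =>
      (D 0).bind fun a => extFun (fun i => D i.succ) (fun x => f (Fin.cons a x))

/-- The ultrafilter extension `β(M)` of an `L`-structure `M`. -/
noncomputable instance ultrafilterStructure (L : Language) (M : Type*) [L.Structure M] :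
    L.Structure (Ultrafilter M) where
  funMap f D := extFun D fun x => Structure.funMap f x
  RelMap r D := extProp D fun x => Structure.RelMap r x

theorem extProp_mono {M : Type*} {n : ℕ} (D : Fin n → Ultrafilter M)
    {φ ψ : (Fin n → M) → Prop} (hφψ : ∀ x, φ x → ψ x) (hφ : extProp D φ) : extProp D ψ := by
  induction n with
  | zero => exact hφψ _ hφ
  | succ n ih =>
    exact Filter.mem_of_superset (f := (D 0 : Filter M)) hφ
      fun a ha => ih _ (fun x => hφψ (Fin.cons a x)) ha

theorem extProp_map {M N : Type*} (h : M → N) {n : ℕ} (D : Fin n → Ultrafilter M)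
    (φ : (Fin n → N) → Prop) :
    extProp (Ultrafilter.map h ∘ D) φ ↔ extProp D fun x => φ (h ∘ x) := by
  induction n with
  | zero =>
    change φ _ ↔ φ _
    rw [Subsingleton.elim (h ∘ Fin.elim0) Fin.elim0]
  | succ n ih =>
    have key (a : M) :
        extProp (Ultrafilter.map h ∘ fun i => D i.succ) (fun x => φ (Fin.cons (h a) x)) ↔
          extProp (fun i => D i.succ) fun x => φ (h ∘ (Fin.cons a x : Fin (n + 1) → M)) := by
      simp only [ih, Fin.comp_cons]
    simp only [extProp, ← key]
    rfl

theorem mem_extFun {M : Type*} {n : ℕ} (D : Fin n → Ultrafilter M) (f : (Fin n → M) → M)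
    (A : Set M) : A ∈ extFun D f ↔ extProp D fun x => f x ∈ A := by
  induction n with
  | zero => exact Ultrafilter.mem_pure
  | succ n ih =>
    change {a | A ∈ extFun (fun i => D i.succ) fun x => f (Fin.cons a x)} ∈ D 0 ↔ _
    simp only [ih, extProp]

theorem map_extFun {M N : Type*} (h : M → N) {n : ℕ} (D : Fin n → Ultrafilter M)
    {f : (Fin n → M) → M} {g : (Fin n → N) → N} (hfg : ∀ x, h (f x) = g (h ∘ x)) :
    (extFun D f).map h = extFun (Ultrafilter.map h ∘ D) g := by
  ext A
  simp only [Ultrafilter.mem_map, mem_extFun, extProp_map, Set.mem_preimage, hfg]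

theorem Ultrafilter.map_surjective {M N : Type*} {h : M → N} (hsurj : Function.Surjective h) :
    Function.Surjective (Ultrafilter.map h) := fun D =>
  ⟨D.map (Function.surjInv hsurj), by
    rw [Ultrafilter.map_map, (Function.rightInverse_surjInv hsurj).comp_eq_id,
      Ultrafilter.map_id]⟩

/-- First Extension Theorem, epimorphism case: if `h : M1 → M2` is a surjective
`L`-homomorphism, then `Ultrafilter.map h` is a surjective `L`-homomorphism
of `β(M1)` onto `β(M2)`. -/
theorem ultrafilterMap_isEpi (L : Language) (M1 M2 : Type*)
    [L.Structure M1] [L.Structure M2] (h : M1 →[L] M2) (hsurj : Function.Surjective ⇑h) :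
    ∃ g : Ultrafilter M1 →[L] Ultrafilter M2,
      ⇑g = Ultrafilter.map ⇑h ∧ Function.Surjective ⇑g := by
  exact ⟨{ toFun := Ultrafilter.map h
           map_fun' := fun f D => map_extFun h D fun x => h.map_fun f x
           map_rel' := fun r D hD =>
             (extProp_map h D _).2 (extProp_mono D (fun x => h.map_rel r x) hD) },
    rfl, Ultrafilter.map_surjective hsurj⟩
end

section
/- Let X be a linearly ordered set and let F : X → X → X be an unordered pairing function on X, i.e., for all a₁, b₁, a₂, b₂ ∈ X, F a₁ b₁ = F a₂ b₂ iff {a₁, b₁} = {a₂, b₂} as sets. If D₁ is a free (non-principal) ultrafilter on X, then there exists an ultrafilter D₂ on X such that F̃(D₁, D₂) ≠ F̃(D₂, D₁), where F̃ is the ultrafilter extension of F. -/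
/-- The ultrafilter extension of a binary operation `F : M → M → M`:
`A ∈ ext2 F D₁ D₂` iff `{a | {b | F a b ∈ A} ∈ D₂} ∈ D₁`. -/
def ext2 {M : Type*} (F : M → M → M) (D₁ D₂ : Ultrafilter M) : Ultrafilter M :=
  D₁.bind fun a => Ultrafilter.map (F a) D₂

/-- The ultrafilter extension of a binary relation `R : M → M → Prop`:
`extRel R D₁ D₂` iff `{a | {b | R a b} ∈ D₂} ∈ D₁`. -/
def extRel {M : Type*} (R : M → M → Prop) (D₁ D₂ : Ultrafilter M) : Prop :=
  {a : M | {b : M | R a b} ∈ D₂} ∈ D₁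

/-- In a well order, there is a set that contains exactly one of any two consecutive elements. -/
theorem exists_set_mem_iff_notMem_of_covBy (α : Type*) [LinearOrder α] [WellFoundedLT α] :
    ∃ P : Set α, ∀ x y, x ⋖ y → (y ∈ P ↔ x ∉ P) := by
  let step : ∀ y : α, (∀ x, x < y → Prop) → Prop := fun y p => ∃ x, ∃ h : x ⋖ y, ¬ p x h.lt
  let P : α → Prop := (wellFounded_lt (α := α)).fix step
  have hP : ∀ y, P y ↔ ∃ x, x ⋖ y ∧ ¬ P x := fun y => by
    have h : P y = step y fun x _ => P x := WellFounded.fix_eq _ step y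
    simp [h, step]
  refine ⟨{x | P x}, fun x y hxy => (hP y).trans ⟨?_, fun hx => ⟨x, hxy, hx⟩⟩⟩
  rintro ⟨z, hzy, hz⟩
  rwa [hxy.unique_left hzy]

/-- A well order without maximum splits into two complementary cofinal sets. -/
theorem exists_cofinal_and_compl_cofinal (α : Type*) [LinearOrder α] [WellFoundedLT α]
    [NoMaxOrder α] :
    ∃ P : Set α, (∀ x, ∃ y ≥ x, y ∈ P) ∧ ∀ x, ∃ y ≥ x, y ∈ Pᶜ := by
  obtain ⟨P, hP⟩ := exists_set_mem_iff_notMem_of_covBy α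
  let _ := SuccOrder.ofLinearWellFoundedLT α
  have hs : ∀ x, Order.succ x ∈ P ↔ x ∉ P := fun x => hP _ _ (Order.covBy_succ x)
  refine ⟨P, fun x => ?_, fun x => ?_⟩ <;> by_cases hx : x ∈ P
  · exact ⟨x, le_rfl, hx⟩
  · exact ⟨_, Order.le_succ x, (hs x).2 hx⟩
  · exact ⟨_, Order.le_succ x, fun h => (hs x).1 h hx⟩
  · exact ⟨x, le_rfl, hx⟩

theorem mem_ext2 {M : Type*} {F : M → M → M} {D₁ D₂ : Ultrafilter M} {A : Set M} :
    A ∈ ext2 F D₁ D₂ ↔ ∀ᶠ a in D₁, ∀ᶠ b in D₂, F a b ∈ A :=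
  Iff.rfl

/-- For a free ultrafilter `D` on a well order, `D`-almost all `x` have `D`-almost all points
above them. -/
theorem eventually_eventually_lt {X : Type*} [LinearOrder X] [WellFoundedLT X]
    {D : Ultrafilter X} (hfree : ¬ ∃ a, D = pure a) : ∀ᶠ x : X in D, ∀ᶠ y : X in D, x < y := by
  by_contra h
  obtain ⟨m, hm, hmin⟩ := (wellFounded_lt (α := X)).has_min {x | ¬ ∀ᶠ y in D, x < y}
    (Ultrafilter.eventually_not.2 h).exists
  refine h ?_
  have hle : ∀ᶠ y in D, ¬ m < y := Ultrafilter.eventually_not.2 hm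
  have hne : ∀ᶠ y in D, y ≠ m := by
    refine Ultrafilter.eventually_not.2 fun h => hfree ⟨m, ?_⟩
    exact Ultrafilter.eq_of_le (Filter.le_pure_iff.2 h)
  filter_upwards [hle, hne] with y hy hym
  by_contra hcon
  exact hmin y hcon (lt_of_le_of_ne (not_lt.1 hy) hym)

/-- For a free ultrafilter `D₁` on a well order, there is an ultrafilter `D₂` that differs from
`D₁` and determines the same cut. -/
theorem exists_ultrafilter_same_cut {X : Type*} [LinearOrder X] [WellFoundedLT X]
    {D₁ : Ultrafilter X} (hfree : ¬ ∃ a, D₁ = pure a) :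
    ∃ (D₂ : Ultrafilter X) (B : Set X), B ∈ D₂ ∧ B ∉ D₁ ∧
      (∀ᶠ b : X in D₂, ∀ᶠ a : X in D₁, b < a) ∧ ∀ᶠ a : X in D₁, ∀ᶠ b : X in D₂, a < b := by
  have hL := eventually_eventually_lt hfree
  let L : Set X := {x | ∀ᶠ y in D₁, x < y}
  have : Nonempty L := nonempty_subtype.2 hL.exists
  have : NoMaxOrder L := ⟨fun x => by
    obtain ⟨y, hy, hxy⟩ := (hL.and x.2).exists
    exact ⟨⟨y, hy⟩, hxy⟩⟩
  obtain ⟨Q, hQ, hQD⟩ : ∃ Q : Set L, (∀ x, ∃ y ≥ x, y ∈ Q) ∧ Subtype.val '' Q ∉ D₁ := by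
    obtain ⟨P, hP, hPc⟩ := exists_cofinal_and_compl_cofinal L
    by_cases h : Subtype.val '' P ∈ D₁
    · refine ⟨Pᶜ, hPc, fun hc => ?_⟩
      obtain ⟨_, ⟨x, hx, rfl⟩, ⟨y, hy, hxy⟩⟩ := Filter.nonempty_of_mem (Filter.inter_mem h hc)
      exact hy (Subtype.val_injective hxy ▸ hx)
    · exact ⟨P, hP, h⟩
  have : (Filter.atTop ⊓ Filter.principal Q).NeBot :=
    Filter.frequently_mem_iff_neBot.1 (Filter.frequently_atTop.2 hQ)
  have hle := Ultrafilter.of_le (Filter.atTop ⊓ Filter.principal Q)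
  refine ⟨(Ultrafilter.of (Filter.atTop ⊓ Filter.principal Q)).map Subtype.val,
    Subtype.val '' Q, ?_, hQD, ?_, ?_⟩
  · exact Filter.image_mem_map (hle (Filter.mem_inf_of_right (Filter.mem_principal_self Q)))
  · exact Filter.eventually_map.2 (Filter.Eventually.of_forall fun x => x.2)
  · filter_upwards [hL] with a ha
    exact hle (Filter.mem_inf_of_left (Filter.Ioi_mem_atTop (⟨a, ha⟩ : L)))

/-- If `F` is an unordered pairing function on a linear order `X` and `D₁` is a free
ultrafilter on `X`, then there is an ultrafilter `D₂` with `F̃(D₁, D₂) ≠ F̃(D₂, D₁)`. -/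
theorem exists_noncommuting_ultrafilter {X : Type*} [LinearOrder X] (F : X → X → X)
    (hF : ∀ a₁ b₁ a₂ b₂ : X, F a₁ b₁ = F a₂ b₂ ↔ ({a₁, b₁} : Set X) = {a₂, b₂})
    (D₁ : Ultrafilter X) (hfree : ¬ ∃ a, D₁ = pure a) :
    ∃ D₂ : Ultrafilter X, ext2 F D₁ D₂ ≠ ext2 F D₂ D₁ := by
  rename_i inst
  clear inst
  obtain ⟨_, _⟩ := exists_wellFoundedLT X
  obtain ⟨D₂, B, hB₂, hB₁, h₂₁, h₁₂⟩ := exists_ultrafilter_same_cut hfree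
  have hBc : ∀ᶠ a in D₁, a ∉ B := Ultrafilter.eventually_not.2 hB₁
  refine ⟨D₂, fun heq => ?_⟩
  let S : Set X := {x | ∃ a b, a ∉ B ∧ b ∈ B ∧ a < b ∧ x = F a b}
  have hS : S ∈ ext2 F D₁ D₂ := by
    rw [mem_ext2]
    filter_upwards [hBc, h₁₂] with a ha hab
    filter_upwards [hB₂, hab] with b hb hlt
    exact ⟨a, b, ha, hb, hlt, rfl⟩
  rw [heq, mem_ext2] at hS
  obtain ⟨b, hbS, hb, hba⟩ := (hS.and (Filter.Eventually.and hB₂ h₂₁)).exists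
  obtain ⟨a, ⟨a', b', ha', hb', hlt, hab⟩, ha, hlt'⟩ := (hbS.and (hBc.and hba)).exists
  rcases Set.pair_eq_pair_iff.1 ((hF _ _ _ _).1 hab) with ⟨rfl, rfl⟩ | ⟨rfl, rfl⟩
  · exact ha' hb
  · exact lt_asymm hlt hlt'
end
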